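/- Let n ≥ 2 be an integer and s > n/2 a real number. A real number λ is an eigenvalue of L_s on [0, π/2] if and only if λ = (s + 2k)(s + 2k + 1 − n) for some integer k ≥ 0. -/

import Mathlib

open Real Set Filter

/-- The operator `(L_s u)(θ) = -u''(θ) - (n+1-2s) cot(θ) u'(θ) + (s-1)(s-n) u(θ)`. -/
noncomputable def Ls (n : ℕ) (s : ℝ) (u : ℝ → ℝ) (θ : ℝ) : ℝ :=
  -deriv (deriv u) θ - ((n : ℝ) + 1 - 2 * s) * Real.cot θ * deriv u θ
    + (s - 1) * (s - (n : ℝ)) * u θ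

/-- `lam` is an eigenvalue of `L_s` on `[0, θ₀]`: there is `v`, the restriction of a
`C^∞` function on `ℝ`, not identically zero on `[0, θ₀]`, such that
`u(θ) = sin(θ)^{2s-n} v(θ)` satisfies `L_s u = lam·u` on `(0, θ₀)` and `u'(θ₀) = 0`. -/
def IsEigenvalue (n : ℕ) (s θ₀ lam : ℝ) : Prop :=
  ∃ V : ℝ → ℝ, ContDiff ℝ (⊤ : ℕ∞) V ∧ (∃ θ ∈ Set.Icc 0 θ₀, V θ ≠ 0) ∧
    (∀ θ ∈ Set.Ioo 0 θ₀,
      Ls n s (fun t => Real.sin t ^ (2 * s - (n : ℝ)) * V t) θ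
        = lam * (Real.sin θ ^ (2 * s - (n : ℝ)) * V θ)) ∧
    deriv (fun t => Real.sin t ^ (2 * s - (n : ℝ)) * V t) θ₀ = 0

lemma hasDerivAt_sin_rpow_mul (a : ℝ) {V : ℝ → ℝ} {V' θ : ℝ} (hV : HasDerivAt V V' θ)
    (hθ : θ ∈ Ioo 0 π) :
    HasDerivAt (fun t => Real.sin t ^ a * V t)
      (Real.sin θ ^ a * (a * (Real.cos θ / Real.sin θ) * V θ + V')) θ := by
  have hs : 0 < Real.sin θ := Real.sin_pos_of_mem_Ioo hθ
  refine (((Real.hasDerivAt_sin θ).rpow_const (p := a) (Or.inl hs.ne')).fun_mul hV).congr_deriv ?_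
  rw [Real.rpow_sub_one hs.ne']
  ring

/-- The conjugated operator `V ↦ sin^{-a} L_s (sin^a V)`, `a = 2s - n`, on the interval `(0, π)`. -/
lemma Ls_sin_rpow_mul (n : ℕ) (s : ℝ) {V : ℝ → ℝ} (hV : Differentiable ℝ V)
    (hV' : Differentiable ℝ (deriv V)) {θ : ℝ} (hθ : θ ∈ Ioo 0 π) :
    Ls n s (fun t => Real.sin t ^ (2 * s - (n : ℝ)) * V t) θ =
      Real.sin θ ^ (2 * s - (n : ℝ)) * (-deriv (deriv V) θ
        - (1 + (2 * s - n)) * (Real.cos θ / Real.sin θ) * deriv V θ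
        + s * (s + 1 - n) * V θ) := by
  have hs : 0 < Real.sin θ := Real.sin_pos_of_mem_Ioo hθ
  set a := 2 * s - (n : ℝ) with ha
  have h1 : deriv (fun t => Real.sin t ^ a * V t) =ᶠ[nhds θ] fun t =>
      Real.sin t ^ a * (a * (Real.cos t / Real.sin t) * V t + deriv V t) := by
    filter_upwards [isOpen_Ioo.mem_nhds hθ] with t ht
    exact (hasDerivAt_sin_rpow_mul a (hV t).hasDerivAt ht).deriv
  have h2 : HasDerivAt (fun t => a * (Real.cos t / Real.sin t) * V t + deriv V t) _ θ :=
    ((((Real.hasDerivAt_cos θ).div (Real.hasDerivAt_sin θ) hs.ne').const_mul a).mul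
      (hV θ).hasDerivAt).add (hV' θ).hasDerivAt
  have h3 := (hasDerivAt_sin_rpow_mul a h2 hθ).deriv
  unfold Ls
  rw [h1.deriv_eq, h3, h1.eq_of_nhds, Real.cot_eq_cos_div_sin]
  have hn : (n : ℝ) = 2 * s - a := by rw [ha]; ring
  rw [hn]
  simp only [Pi.div_apply]
  field_simp
  ring_nf

lemma hasDerivAt_cos_pow_even (j : ℕ) (θ : ℝ) :
    HasDerivAt (fun t => Real.cos t ^ (2 * j))
      (-(2 * j) * Real.cos θ ^ (2 * j - 1) * Real.sin θ) θ := by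
  refine ((Real.hasDerivAt_cos θ).fun_pow (2 * j)).congr_deriv ?_
  push_cast
  ring

lemma hasDerivAt_deriv_cos_pow_even (j : ℕ) (θ : ℝ) :
    HasDerivAt (fun t => -(2 * (j : ℝ)) * Real.cos t ^ (2 * j - 1) * Real.sin t)
      (2 * j * (2 * j - 1) * Real.cos θ ^ (2 * j - 2) * Real.sin θ ^ 2
        - 2 * j * Real.cos θ ^ (2 * j)) θ := by
  refine ((((Real.hasDerivAt_cos θ).fun_pow (2 * j - 1)).const_mul (-(2 * (j : ℝ)))).fun_mul
    (Real.hasDerivAt_sin θ)).congr_deriv ?_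
  rcases j with _ | j
  · simp
  · simp only [show 2 * (j + 1) - 1 = 2 * j + 1 by omega,
      show 2 * (j + 1) - 2 = 2 * j by omega, show 2 * j + 1 - 1 = 2 * j by omega]
    push_cast
    ring

/-- The image of `cos^{2j}` under `f ↦ f'' + (1 + a) cot f'`. -/
noncomputable def gegenbauerMonomial (a : ℝ) (j : ℕ) (θ : ℝ) : ℝ :=
  2 * j * (2 * j - 1) * Real.cos θ ^ (2 * j - 2)
    - 2 * j * (2 * j + 1 + a) * Real.cos θ ^ (2 * j)

lemma gegenbauerMonomial_eq (a : ℝ) (j : ℕ) (θ : ℝ) :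
    (2 * j * (2 * j - 1) * Real.cos θ ^ (2 * j - 2) * Real.sin θ ^ 2
        - 2 * j * Real.cos θ ^ (2 * j))
      - (1 + a) * Real.cos θ * (2 * j * Real.cos θ ^ (2 * j - 1)) =
    gegenbauerMonomial a j θ := by
  unfold gegenbauerMonomial
  rcases j with _ | j
  · simp
  · simp only [show 2 * (j + 1) - 1 = 2 * j + 1 by omega,
      show 2 * (j + 1) - 2 = 2 * j by omega, Real.sin_sq]
    push_cast
    ring

/-- Coefficients of the even polynomial solution of Gegenbauer's equation. -/
noncomputable def gegenbauerCoeff (a μ : ℝ) : ℕ → ℝ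
  | 0 => 1
  | i + 1 => (2 * i * (2 * i + 1 + a) - μ) / ((2 * i + 2) * (2 * i + 1)) * gegenbauerCoeff a μ i

lemma sum_gegenbauerCoeff (a μ : ℝ) (θ : ℝ) (m : ℕ) :
    ∑ i ∈ Finset.range (m + 1), gegenbauerCoeff a μ i *
        (gegenbauerMonomial a i θ + μ * Real.cos θ ^ (2 * i)) =
      gegenbauerCoeff a μ m * (μ - 2 * m * (2 * m + 1 + a)) * Real.cos θ ^ (2 * m) := by
  induction m with
  | zero => simp [gegenbauerMonomial]
  | succ m ih =>
    rw [Finset.sum_range_succ, ih, gegenbauerCoeff, gegenbauerMonomial,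
      show 2 * (m + 1) - 2 = 2 * m by omega]
    have h1 : (2 * (m : ℝ) + 2) ≠ 0 := by positivity
    have h2 : (2 * (m : ℝ) + 1) ≠ 0 := by positivity
    push_cast
    field_simp
    ring

lemma isEigenvalue_pi_div_two (n : ℕ) (s : ℝ) (k : ℕ) :
    IsEigenvalue n s (π / 2) ((s + 2 * (k : ℝ)) * (s + 2 * (k : ℝ) + 1 - (n : ℝ))) := by
  set a := 2 * s - (n : ℝ) with ha
  set μ := 2 * (k : ℝ) * (2 * k + 1 + a) with hμ
  set b := gegenbauerCoeff a μ with hb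
  set V : ℝ → ℝ := fun θ => ∑ i ∈ Finset.range (k + 1), b i * Real.cos θ ^ (2 * i) with hVdef
  have hd1 : ∀ θ, HasDerivAt V (∑ i ∈ Finset.range (k + 1),
      b i * (-(2 * i) * Real.cos θ ^ (2 * i - 1) * Real.sin θ)) θ := fun θ =>
    HasDerivAt.fun_sum fun i _ => (hasDerivAt_cos_pow_even i θ).const_mul (b i)
  have hd1' : deriv V = fun θ => ∑ i ∈ Finset.range (k + 1),
      b i * (-(2 * i) * Real.cos θ ^ (2 * i - 1) * Real.sin θ) := funext fun θ => (hd1 θ).deriv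
  have hd2 : ∀ θ, HasDerivAt (deriv V) (∑ i ∈ Finset.range (k + 1),
      b i * (2 * i * (2 * i - 1) * Real.cos θ ^ (2 * i - 2) * Real.sin θ ^ 2
        - 2 * i * Real.cos θ ^ (2 * i))) θ := fun θ => by
    rw [hd1']
    exact HasDerivAt.fun_sum fun i _ => (hasDerivAt_deriv_cos_pow_even i θ).const_mul (b i)
  have hpi := Real.pi_pos
  refine ⟨V, ?_, ⟨π / 2, ⟨by positivity, le_rfl⟩, ?_⟩, ?_, ?_⟩
  · exact ContDiff.sum fun i _ => contDiff_const.mul (Real.contDiff_cos.pow _)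
  · simp [hVdef, Finset.sum_range_succ', hb, gegenbauerCoeff]
  · intro θ hθ
    have hθ' : θ ∈ Ioo 0 π := ⟨hθ.1, by linarith [hθ.2]⟩
    have hs : 0 < Real.sin θ := Real.sin_pos_of_mem_Ioo hθ'
    rw [Ls_sin_rpow_mul n s (fun t => (hd1 t).differentiableAt)
      (fun t => (hd2 t).differentiableAt) hθ', ← ha]
    have key : deriv (deriv V) θ + (1 + a) * (Real.cos θ / Real.sin θ) * deriv V θ
        + μ * V θ = 0 := by
      have h0 := sum_gegenbauerCoeff a μ θ k
      rw [← hμ, sub_self, mul_zero, zero_mul] at h0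
      rw [← h0, (hd2 θ).deriv, (hd1 θ).deriv, hVdef]
      simp only [Finset.mul_sum, ← Finset.sum_add_distrib]
      refine Finset.sum_congr rfl fun i _ => ?_
      rw [← gegenbauerMonomial_eq, ← hb]
      field_simp
      ring
    have hn : (n : ℝ) = 2 * s - a := by rw [ha]; ring
    rw [hn]
    linear_combination (-Real.sin θ ^ a) * key + Real.sin θ ^ a * V θ * hμ
  · have h := (hasDerivAt_sin_rpow_mul a (hd1 (π / 2)) ⟨by positivity, by linarith⟩).deriv
    rw [h]
    simp only [Real.cos_pi_div_two, Real.sin_pi_div_two]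
    rw [Finset.sum_eq_zero]
    · simp
    · intro i _
      rcases i with _ | i
      · simp
      · simp [show 2 * (i + 1) - 1 = 2 * i + 1 by omega]

section Moments

variable {a μ : ℝ} {V : ℝ → ℝ}

lemma gegenbauer_green (ha : 0 < a) (hV : ContDiff ℝ 2 V)
    (hode : ∀ θ ∈ Ioo 0 (π / 2),
      deriv (deriv V) θ + (1 + a) * (Real.cos θ / Real.sin θ) * deriv V θ + μ * V θ = 0)
    (hbd : deriv V (π / 2) = 0) (j : ℕ) :
    ∫ θ in (0 : ℝ)..π / 2, Real.sin θ ^ (1 + a) * V θ *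
      (gegenbauerMonomial a j θ + μ * Real.cos θ ^ (2 * j)) = 0 := by
  have hpi := Real.pi_pos
  have hVd : Differentiable ℝ V := hV.differentiable (by norm_num)
  have hV1 : ContDiff ℝ 1 (deriv V) := ContDiff.deriv' hV
  have hV1d : Differentiable ℝ (deriv V) := hV1.differentiable (by norm_num)
  have hw : Continuous fun θ => Real.sin θ ^ (1 + a) :=
    Real.continuous_sin.rpow_const fun _ => Or.inr (by positivity)
  have hg : Continuous (gegenbauerMonomial a j) := by
    unfold gegenbauerMonomial
    fun_prop
  have hVc := hV.continuous
  have hV1c := hV1.continuous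
  have h := intervalIntegral.integral_eq_sub_of_hasDerivAt_of_le
    (f := fun θ => -(Real.sin θ ^ (1 + a) * (deriv V θ * Real.cos θ ^ (2 * j)
      - V θ * (-(2 * j) * Real.cos θ ^ (2 * j - 1) * Real.sin θ))))
    (f' := fun θ => Real.sin θ ^ (1 + a) * V θ *
      (gegenbauerMonomial a j θ + μ * Real.cos θ ^ (2 * j)))
    (a := 0) (b := π / 2) (by positivity) (by fun_prop) ?_
    (Continuous.intervalIntegrable (by fun_prop) _ _)
  · rw [h]
    have h0 : (0 : ℝ) ^ (1 + a) = 0 := Real.zero_rpow (by positivity)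
    rcases j with _ | j
    · simp [hbd, h0]
    · simp [hbd, h0, show 2 * (j + 1) - 1 = 2 * j + 1 by omega]
  · intro θ hθ
    have hs : 0 < Real.sin θ := Real.sin_pos_of_mem_Ioo ⟨hθ.1, by linarith [hθ.2]⟩
    have hwd := (Real.hasDerivAt_sin θ).rpow_const (p := 1 + a) (Or.inl hs.ne')
    refine (hwd.fun_mul (((hV1d θ).hasDerivAt.fun_mul (hasDerivAt_cos_pow_even j θ)).fun_sub
      ((hVd θ).hasDerivAt.fun_mul (hasDerivAt_deriv_cos_pow_even j θ)))).fun_neg.congr_deriv ?_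
    have hode' : deriv (deriv V) θ * Real.sin θ =
        -(1 + a) * Real.cos θ * deriv V θ - μ * V θ * Real.sin θ := by
      have := hode θ hθ
      field_simp at this
      linear_combination this
    rw [← gegenbauerMonomial_eq, Real.rpow_add hs, Real.rpow_one,
      show 1 + a - 1 = a by ring]
    linear_combination (-Real.sin θ ^ a * Real.cos θ ^ (2 * j)) * hode'

lemma gegenbauer_moment_eq_zero (ha : 0 < a) (hV : ContDiff ℝ 2 V)
    (hode : ∀ θ ∈ Ioo 0 (π / 2),
      deriv (deriv V) θ + (1 + a) * (Real.cos θ / Real.sin θ) * deriv V θ + μ * V θ = 0)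
    (hbd : deriv V (π / 2) = 0) (hμ : ∀ k : ℕ, μ ≠ 2 * k * (2 * k + 1 + a)) (j : ℕ) :
    ∫ θ in (0 : ℝ)..π / 2, Real.sin θ ^ (1 + a) * V θ * Real.cos θ ^ (2 * j) = 0 := by
  have hw : Continuous fun θ => Real.sin θ ^ (1 + a) :=
    Real.continuous_sin.rpow_const fun _ => Or.inr (by positivity)
  have hVc := hV.continuous
  have hint : ∀ m : ℕ, IntervalIntegrable (fun θ => Real.sin θ ^ (1 + a) * V θ *
      Real.cos θ ^ m) MeasureTheory.volume 0 (π / 2) := fun m =>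
    Continuous.intervalIntegrable (by fun_prop) _ _
  have hrec : ∀ j : ℕ,
      2 * j * (2 * j - 1) * (∫ θ in (0 : ℝ)..π / 2,
          Real.sin θ ^ (1 + a) * V θ * Real.cos θ ^ (2 * j - 2)) +
        (μ - 2 * j * (2 * j + 1 + a)) * (∫ θ in (0 : ℝ)..π / 2,
          Real.sin θ ^ (1 + a) * V θ * Real.cos θ ^ (2 * j)) = 0 := by
    intro j
    refine Eq.trans ?_ (gegenbauer_green ha hV hode hbd j)
    rw [← intervalIntegral.integral_const_mul,
      ← intervalIntegral.integral_const_mul,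
      ← intervalIntegral.integral_add ((hint _).const_mul _) ((hint _).const_mul _)]
    refine intervalIntegral.integral_congr fun θ _ => ?_
    simp only [gegenbauerMonomial]
    ring
  induction j with
  | zero => simpa using (mul_eq_zero.1 (by simpa using hrec 0)).resolve_left (by simpa using hμ 0)
  | succ j ih =>
    have h := hrec (j + 1)
    rw [show 2 * (j + 1) - 2 = 2 * j by omega, ih, mul_zero, zero_add] at h
    exact (mul_eq_zero.1 h).resolve_left (sub_ne_zero.2 (hμ (j + 1)))

end Moments

/-- A continuous function on `[0, π/2]` all of whose weighted even cosine moments vanish is zero. -/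
lemma eq_zero_of_cos_moments_eq_zero {r : ℝ} (hr : 0 < r) {V : ℝ → ℝ} (hV : Continuous V)
    (hmom : ∀ j : ℕ,
      ∫ θ in (0 : ℝ)..π / 2, Real.sin θ ^ r * V θ * Real.cos θ ^ (2 * j) = 0) :
    ∀ θ ∈ Icc 0 (π / 2), V θ = 0 := by
  have hpi := Real.pi_pos
  have hw : Continuous fun θ => Real.sin θ ^ r :=
    Real.continuous_sin.rpow_const fun _ => Or.inr hr.le
  have hsin : ∀ θ ∈ Icc 0 (π / 2), 0 ≤ Real.sin θ ^ r := fun θ hθ =>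
    Real.rpow_nonneg (Real.sin_nonneg_of_nonneg_of_le_pi hθ.1 (by linarith [hθ.2])) _
  have hpoly : ∀ p : Polynomial ℝ,
      ∫ θ in (0 : ℝ)..π / 2, Real.sin θ ^ r * V θ * p.eval (Real.cos θ ^ 2) = 0 := by
    intro p
    simp only [Polynomial.eval_eq_sum_range, Finset.mul_sum]
    rw [intervalIntegral.integral_finsetSum]
    · refine Finset.sum_eq_zero fun i _ => ?_
      refine Eq.trans ?_ (mul_eq_zero_of_right (p.coeff i) (hmom i))
      rw [← intervalIntegral.integral_const_mul]
      refine intervalIntegral.integral_congr fun θ _ => ?_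
      simp only [pow_mul]
      ring
    · intro i _
      exact Continuous.intervalIntegrable (by fun_prop) _ _
  set C := ∫ θ in (0 : ℝ)..π / 2, Real.sin θ ^ r * |V θ| with hC
  have hsq_nonneg : ∀ θ ∈ Icc 0 (π / 2), 0 ≤ Real.sin θ ^ r * V θ ^ 2 := fun θ hθ =>
    mul_nonneg (hsin θ hθ) (sq_nonneg _)
  have hle : ∀ ε > 0, ∫ θ in (0 : ℝ)..π / 2, Real.sin θ ^ r * V θ ^ 2 ≤ ε * C := by
    intro ε hε
    obtain ⟨p, hp⟩ := exists_polynomial_near_of_continuousOn 0 1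
      (fun y => V (Real.arccos (Real.sqrt y)))
      (hV.comp (Real.continuous_arccos.comp Real.continuous_sqrt)).continuousOn ε hε
    have hp' : ∀ θ ∈ Icc 0 (π / 2), |V θ - p.eval (Real.cos θ ^ 2)| ≤ ε := by
      intro θ hθ
      have hcos : 0 ≤ Real.cos θ :=
        Real.cos_nonneg_of_mem_Icc ⟨by linarith [hθ.1], hθ.2⟩
      have h := hp (Real.cos θ ^ 2) ⟨sq_nonneg _, Real.cos_sq_le_one θ⟩
      rw [Real.sqrt_sq hcos, Real.arccos_cos hθ.1 (by linarith [hθ.2]), abs_sub_comm] at h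
      exact h.le
    have hpc : Continuous fun θ => p.eval (Real.cos θ ^ 2) :=
      p.continuous.comp (Real.continuous_cos.pow 2)
    calc ∫ θ in (0 : ℝ)..π / 2, Real.sin θ ^ r * V θ ^ 2
        = (∫ θ in (0 : ℝ)..π / 2, Real.sin θ ^ r * V θ ^ 2) -
          ∫ θ in (0 : ℝ)..π / 2, Real.sin θ ^ r * V θ * p.eval (Real.cos θ ^ 2) := by
          rw [hpoly p, sub_zero]
      _ = ∫ θ in (0 : ℝ)..π / 2, (Real.sin θ ^ r * V θ ^ 2 -
            Real.sin θ ^ r * V θ * p.eval (Real.cos θ ^ 2)) :=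
          (intervalIntegral.integral_sub (Continuous.intervalIntegrable (by fun_prop) _ _)
            (Continuous.intervalIntegrable (by fun_prop) _ _)).symm
      _ ≤ ∫ θ in (0 : ℝ)..π / 2, ε * (Real.sin θ ^ r * |V θ|) := by
          refine intervalIntegral.integral_mono_on (by positivity)
            (Continuous.intervalIntegrable (by fun_prop) _ _)
            (Continuous.intervalIntegrable (by fun_prop) _ _) fun θ hθ => ?_
          have h1 : V θ * (V θ - p.eval (Real.cos θ ^ 2)) ≤ |V θ| * ε :=
            (le_abs_self _).trans ((abs_mul _ _).le.trans
              (mul_le_mul_of_nonneg_left (hp' θ hθ) (abs_nonneg _)))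
          nlinarith [mul_le_mul_of_nonneg_left h1 (hsin θ hθ)]
      _ = ε * C := intervalIntegral.integral_const_mul _ _
  have hC0 : 0 ≤ C := intervalIntegral.integral_nonneg (by positivity) fun θ hθ =>
    mul_nonneg (hsin θ hθ) (abs_nonneg _)
  have hint : ∫ θ in (0 : ℝ)..π / 2, Real.sin θ ^ r * V θ ^ 2 ≤ 0 := by
    refine le_of_forall_pos_le_add fun δ hδ => ?_
    refine (hle (δ / (C + 1)) (by positivity)).trans ?_
    rw [zero_add, div_mul_eq_mul_div, div_le_iff₀ (by positivity)]
    nlinarith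
  have hioo : ∀ θ ∈ Ioo 0 (π / 2), V θ = 0 := by
    intro θ hθ
    by_contra hne
    refine hint.not_gt (intervalIntegral.integral_pos (by positivity)
      (by fun_prop) (fun t ht => hsq_nonneg t (Ioc_subset_Icc_self ht))
      ⟨θ, Ioo_subset_Icc_self hθ, ?_⟩)
    have := Real.sin_pos_of_mem_Ioo (x := θ) ⟨hθ.1, by linarith [hθ.2]⟩
    positivity
  have hcl : Icc 0 (π / 2) ⊆ {θ | V θ = 0} := by
    rw [← closure_Ioo (by positivity : (0 : ℝ) ≠ π / 2)]
    exact closure_minimal hioo (isClosed_eq hV continuous_const)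
  exact fun θ hθ => hcl hθ

/-- the eigenvalues of `L_s` on `[0, π/2]` are exactly the numbers
`(s+2k)(s+2k+1-n)` for integers `k ≥ 0`. -/
theorem stmt_11 (n : ℕ) (hn : 2 ≤ n) (s : ℝ) (hs : (n : ℝ) / 2 < s) (lam : ℝ) :
    IsEigenvalue n s (Real.pi / 2) lam ↔
      ∃ k : ℕ, lam = (s + 2 * (k : ℝ)) * (s + 2 * (k : ℝ) + 1 - (n : ℝ)) := by
  constructor
  · rintro ⟨V, hV, ⟨θ₁, hθ₁, hne⟩, hode, hbd⟩
    by_contra! hlam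
    have hpi := Real.pi_pos
    have hV2 : ContDiff ℝ 2 V := contDiff_infty.1 hV 2
    have hVd : Differentiable ℝ V := hV2.differentiable (by norm_num)
    have hV1 : ContDiff ℝ 1 (deriv V) := ContDiff.deriv' hV2
    have hV1d : Differentiable ℝ (deriv V) := hV1.differentiable (by norm_num)
    have ha : 0 < 2 * s - (n : ℝ) := by linarith
    refine hne (eq_zero_of_cos_moments_eq_zero (r := 1 + (2 * s - n)) (by positivity)
      hV.continuous (gegenbauer_moment_eq_zero (μ := lam - s * (s + 1 - n)) ha hV2 ?_ ?_ ?_)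
      θ₁ hθ₁)
    · intro θ hθ
      have hθ' : θ ∈ Ioo 0 π := ⟨hθ.1, by linarith [hθ.2]⟩
      have h := hode θ hθ
      rw [Ls_sin_rpow_mul n s hVd hV1d hθ', mul_left_comm] at h
      have hpos := Real.rpow_pos_of_pos (Real.sin_pos_of_mem_Ioo hθ') (2 * s - (n : ℝ))
      linear_combination -(mul_left_cancel₀ hpos.ne' h)
    · rw [(hasDerivAt_sin_rpow_mul _ (hVd (π / 2)).hasDerivAt
        ⟨by positivity, by linarith⟩).deriv] at hbd
      simpa using hbd
    · intro k hk
      exact hlam k (by linear_combination hk)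
  · rintro ⟨k, rfl⟩
    exact isEigenvalue_pi_div_two n s k
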